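/- arXiv:1008.4917 — 10 statements merged into one kernel-verified Lean document; each statement's English description precedes it below -/
import Mathlib

section
/- Let 0 = φ_A < φ_B < φ_C < φ_D < 2π be real numbers and set v_R = (cos φ_R, sin φ_R) ∈ ℝ² for R ∈ {A,B,C,D}. Suppose (w_A,w_B,w_C,w_D) and (w'_A,w'_B,w'_C,w'_D) are quadruples of positive reals both satisfying the balancing condition w_A·v_A + w_B·v_B + w_C·v_C + w_D·v_D = 0 and w'_A·v_A + w'_B·v_B + w'_C·v_C + w'_D·v_D = 0, and having equal total weight w_A+w_B+w_C+w_D = w'_A+w'_B+w'_C+w'_D. If w'_D > w_D, then w'_A < w_A, w'_C < w_C and w'_B > w_B; that is, an increase of the weight corresponding to one ray causes a decrease of the weights corresponding to the two neighbouring rays and an increase of the weight corresponding to the opposite ray (the plasticity principle of convex quadrilaterals, planar form). -/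
open Real

/-- Twice the signed area of the triangle inscribed in the unit circle at angles `a, b, c`. -/
lemma inscribed_area_pos (a b c : ℝ) (hab : a < b) (hbc : b < c) (hca : c < a + 2 * π) :
    0 < cos a * sin b - sin a * cos b + (cos b * sin c - sin b * cos c)
      + (cos c * sin a - sin c * cos a) := by
  have key : ∀ x y : ℝ, sin (2 * x) + sin (2 * y) - sin (2 * (x + y))
      = 4 * sin x * sin y * sin (x + y) := by
    intro x y
    rw [sin_two_mul, sin_two_mul, sin_two_mul, sin_add, cos_add]
    have hx := sin_sq_add_cos_sq x
    have hy := sin_sq_add_cos_sq y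
    linear_combination (-2 * sin y * cos y) * hx + (-2 * sin x * cos x) * hy
  have h := key ((b - a) / 2) ((c - b) / 2)
  have e1 : 2 * ((b - a) / 2) = b - a := by ring
  have e2 : 2 * ((c - b) / 2) = c - b := by ring
  have e3 : (b - a) / 2 + (c - b) / 2 = (c - a) / 2 := by ring
  have e4 : 2 * ((c - a) / 2) = c - a := by ring
  rw [e3, e1, e2, e4, sin_sub, sin_sub, sin_sub] at h
  have p1 : 0 < sin ((b - a) / 2) := sin_pos_of_pos_of_lt_pi (by linarith) (by linarith)
  have p2 : 0 < sin ((c - b) / 2) := sin_pos_of_pos_of_lt_pi (by linarith) (by linarith)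
  have p3 : 0 < sin ((c - a) / 2) := sin_pos_of_pos_of_lt_pi (by linarith) (by linarith)
  have : 0 < 4 * sin ((b - a) / 2) * sin ((c - b) / 2) * sin ((c - a) / 2) := by positivity
  linarith

/-- The plasticity principle of convex quadrilaterals, planar form. -/
theorem plasticity_principle_planar
    (φA φB φC φD : ℝ)
    (hφA : φA = 0) (hAB : φA < φB) (hBC : φB < φC) (hCD : φC < φD)
    (hD : φD < 2 * π)
    (wA wB wC wD wA' wB' wC' wD' : ℝ)
    (hwA : 0 < wA) (hwB : 0 < wB) (hwC : 0 < wC) (hwD : 0 < wD)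
    (hwA' : 0 < wA') (hwB' : 0 < wB') (hwC' : 0 < wC') (hwD' : 0 < wD')
    (hbal : wA • ((cos φA, sin φA) : ℝ × ℝ) + wB • ((cos φB, sin φB) : ℝ × ℝ)
      + wC • ((cos φC, sin φC) : ℝ × ℝ) + wD • ((cos φD, sin φD) : ℝ × ℝ) = 0)
    (hbal' : wA' • ((cos φA, sin φA) : ℝ × ℝ) + wB' • ((cos φB, sin φB) : ℝ × ℝ)
      + wC' • ((cos φC, sin φC) : ℝ × ℝ) + wD' • ((cos φD, sin φD) : ℝ × ℝ) = 0)
    (hsum : wA + wB + wC + wD = wA' + wB' + wC' + wD')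
    (hinc : wD < wD') :
    wA' < wA ∧ wC' < wC ∧ wB < wB' := by
  have hABC := inscribed_area_pos φA φB φC hAB hBC (by linarith)
  have hBCD := inscribed_area_pos φB φC φD hBC hCD (by linarith)
  have hABD := inscribed_area_pos φA φB φD hAB (by linarith) (by linarith)
  have hACD := inscribed_area_pos φA φC φD (by linarith) hCD (by linarith)
  simp only [Prod.smul_mk, smul_eq_mul, Prod.mk_add_mk, Prod.mk_eq_zero] at hbal hbal'
  obtain ⟨h1, h2⟩ := hbal
  obtain ⟨h1', h2'⟩ := hbal'
  clear hφA
  generalize cos φA = ca at *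
  generalize sin φA = sa at *
  generalize cos φB = cb at *
  generalize sin φB = sb at *
  generalize cos φC = cc at *
  generalize sin φC = sc at *
  generalize cos φD = cd at *
  generalize sin φD = sd at *
  have hd : 0 < wD' - wD := by linarith
  have c1 := h1'.trans h1.symm
  have c2 := h2'.trans h2.symm
  refine ⟨?_, ?_, ?_⟩
  · have q := mul_pos hd hBCD
    by_contra! hc
    have r := mul_nonneg (sub_nonneg.2 hc) hABC.le
    refine absurd (add_pos_of_pos_of_nonneg q r) (not_lt.2 (le_of_eq ?_))
    linear_combination (sb - sc) * c1 + (cc - cb) * c2 - (cb * sc - sb * cc) * hsum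
  · have q := mul_pos hd hABD
    by_contra! hc
    have r := mul_nonneg (sub_nonneg.2 hc) hABC.le
    refine absurd (add_pos_of_pos_of_nonneg q r) (not_lt.2 (le_of_eq ?_))
    linear_combination (sa - sb) * c1 + (cb - ca) * c2 - (ca * sb - sa * cb) * hsum
  · have q := mul_pos hd hACD
    by_contra! hc
    have r := mul_nonneg (sub_nonneg.2 hc) hABC.le
    refine absurd (add_pos_of_pos_of_nonneg q r) (not_lt.2 (le_of_eq ?_))
    linear_combination (sa - sc) * c1 + (cc - ca) * c2 - (ca * sc - sa * cc) * hsum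
end

section
/- Let v_A, v_B, v_C, v_D be unit vectors in ℝ² such that v_A, v_B, v_C are pairwise distinct. Then the linear subspace K = { u ∈ ℝ⁴ : u_A·v_A + u_B·v_B + u_C·v_C + u_D·v_D = 0 and u_A + u_B + u_C + u_D = 0 } has dimension exactly 1, and every nonzero u ∈ K has u_D ≠ 0. Consequently, among all weight quadruples with a fixed total sum satisfying the balancing condition, the weights w_A, w_B, w_C are determined as affine functions of the single variable weight w_D. -/
/-- Three distinct points of the unit circle are not collinear. -/
lemma circle_det_ne_zero (a₀ a₁ b₀ b₁ c₀ c₁ : ℝ)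
    (hA : a₀ ^ 2 + a₁ ^ 2 = 1) (hB : b₀ ^ 2 + b₁ ^ 2 = 1) (hC : c₀ ^ 2 + c₁ ^ 2 = 1)
    (hAB : ¬ (a₀ = b₀ ∧ a₁ = b₁)) (hAC : ¬ (a₀ = c₀ ∧ a₁ = c₁))
    (hBC : ¬ (b₀ = c₀ ∧ b₁ = c₁)) :
    (b₀ - a₀) * (c₁ - a₁) - (b₁ - a₁) * (c₀ - a₀) ≠ 0 := by
  intro h
  have pos : ∀ x y z t : ℝ, ¬ (x = z ∧ y = t) → (z - x) ^ 2 + (t - y) ^ 2 ≠ 0 := by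
    intro x y z t hn h0
    apply hn
    constructor
    · nlinarith [sq_nonneg (z - x), sq_nonneg (t - y)]
    · nlinarith [sq_nonneg (z - x), sq_nonneg (t - y)]
  have hp := pos _ _ _ _ hAB
  have hq := pos _ _ _ _ hAC
  have hr := pos _ _ _ _ hBC
  obtain ⟨p₀, rfl⟩ : ∃ p, b₀ = a₀ + p := ⟨b₀ - a₀, by ring⟩
  obtain ⟨p₁, rfl⟩ : ∃ p, b₁ = a₁ + p := ⟨b₁ - a₁, by ring⟩
  obtain ⟨q₀, rfl⟩ : ∃ p, c₀ = a₀ + p := ⟨c₀ - a₀, by ring⟩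
  obtain ⟨q₁, rfl⟩ : ∃ p, c₁ = a₁ + p := ⟨c₁ - a₁, by ring⟩
  simp only [add_sub_cancel_left, add_sub_add_left_eq_sub] at h hp hq hr
  have e1 : 2 * (a₀ * p₀ + a₁ * p₁) + (p₀ ^ 2 + p₁ ^ 2) = 0 := by
    linear_combination hB - hA
  have e2 : 2 * (a₀ * q₀ + a₁ * q₁) + (q₀ ^ 2 + q₁ ^ 2) = 0 := by
    linear_combination hC - hA
  have f1 : (p₀ ^ 2 + p₁ ^ 2) * ((q₀ ^ 2 + q₁ ^ 2) - (p₀ * q₀ + p₁ * q₁)) = 0 := by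
    linear_combination (p₀ ^ 2 + p₁ ^ 2) * e2 - (p₀ * q₀ + p₁ * q₁) * e1
      + 2 * (a₀ * p₁ - a₁ * p₀) * h
  have f2 : (q₀ ^ 2 + q₁ ^ 2) * ((p₀ ^ 2 + p₁ ^ 2) - (p₀ * q₀ + p₁ * q₁)) = 0 := by
    linear_combination (q₀ ^ 2 + q₁ ^ 2) * e1 - (p₀ * q₀ + p₁ * q₁) * e2
      - 2 * (a₀ * q₁ - a₁ * q₀) * h
  have g1 := (mul_eq_zero.mp f1).resolve_left hp
  have g2 := (mul_eq_zero.mp f2).resolve_left hq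
  exact hr (by linear_combination g1 + g2)

/-- Corollary 1 (structural form): the solution space of the homogeneous
4-inverse weighted Fermat–Torricelli system is one-dimensional, every nonzero
solution has nonzero last coordinate, and consequently, for a fixed total
weight, the weights `w_A, w_B, w_C` are affine functions of `w_D`. -/
theorem inverse_FT_solution_space_dim_one
    (vA vB vC vD : EuclideanSpace ℝ (Fin 2))
    (huA : ‖vA‖ = 1) (huB : ‖vB‖ = 1) (huC : ‖vC‖ = 1) (huD : ‖vD‖ = 1)
    (hAB : vA ≠ vB) (hAC : vA ≠ vC) (hBC : vB ≠ vC)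
    (K : Submodule ℝ (Fin 4 → ℝ))
    (hK : ∀ u : Fin 4 → ℝ,
      u ∈ K ↔ u 0 • vA + u 1 • vB + u 2 • vC + u 3 • vD = 0
        ∧ u 0 + u 1 + u 2 + u 3 = 0) :
    Module.finrank ℝ K = 1
    ∧ (∀ u ∈ K, u ≠ 0 → u 3 ≠ 0)
    ∧ ∀ c : ℝ, ∃ aA bA aB bB aC bC : ℝ, ∀ w : Fin 4 → ℝ,
        w 0 • vA + w 1 • vB + w 2 • vC + w 3 • vD = 0 →
        w 0 + w 1 + w 2 + w 3 = c →
        w 0 = aA * w 3 + bA ∧ w 1 = aB * w 3 + bB ∧ w 2 = aC * w 3 + bC := by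
  have nrm : ∀ v : EuclideanSpace ℝ (Fin 2), ‖v‖ = 1 → v 0 ^ 2 + v 1 ^ 2 = 1 := by
    intro v hv
    have := EuclideanSpace.real_norm_sq_eq v
    rw [hv, Fin.sum_univ_two] at this
    linarith
  have ne : ∀ v w : EuclideanSpace ℝ (Fin 2), v ≠ w → ¬ (v 0 = w 0 ∧ v 1 = w 1) := by
    intro v w h hh
    apply h
    ext i
    fin_cases i
    · exact hh.1
    · exact hh.2
  have hΔ := circle_det_ne_zero _ _ _ _ _ _ (nrm _ huA) (nrm _ huB) (nrm _ huC)
    (ne _ _ hAB) (ne _ _ hAC) (ne _ _ hBC)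
  have bal : ∀ w : Fin 4 → ℝ, w 0 • vA + w 1 • vB + w 2 • vC + w 3 • vD = 0 ↔
      (w 0 * vA 0 + w 1 * vB 0 + w 2 * vC 0 + w 3 * vD 0 = 0 ∧
       w 0 * vA 1 + w 1 * vB 1 + w 2 * vC 1 + w 3 * vD 1 = 0) := by
    intro w
    constructor
    · intro h
      have h0 := congrArg (fun v : EuclideanSpace ℝ (Fin 2) => v 0) h
      have h1 := congrArg (fun v : EuclideanSpace ℝ (Fin 2) => v 1) h
      exact ⟨by simpa using h0, by simpa using h1⟩
    · rintro ⟨h0, h1⟩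
      ext i
      fin_cases i
      · simpa using h0
      · simpa using h1
  simp only [bal] at hK ⊢
  clear bal nrm ne huA huB huC huD hAB hAC hBC
  generalize vA 0 = a₀ at *
  generalize vA 1 = a₁ at *
  generalize vB 0 = b₀ at *
  generalize vB 1 = b₁ at *
  generalize vC 0 = c₀ at *
  generalize vC 1 = c₁ at *
  generalize vD 0 = d₀ at *
  generalize vD 1 = d₁ at *
  set Δ := (b₀ - a₀) * (c₁ - a₁) - (b₁ - a₁) * (c₀ - a₀) with hΔdef
  -- Cramer rule
  have key : ∀ c : ℝ, ∀ w : Fin 4 → ℝ,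
      (w 0 * a₀ + w 1 * b₀ + w 2 * c₀ + w 3 * d₀ = 0 ∧
       w 0 * a₁ + w 1 * b₁ + w 2 * c₁ + w 3 * d₁ = 0) →
      w 0 + w 1 + w 2 + w 3 = c →
      w 0 = (-((b₀ - d₀) * (c₁ - d₁) - (b₁ - d₁) * (c₀ - d₀)) / Δ) * w 3
          + c * (b₀ * c₁ - b₁ * c₀) / Δ ∧
      w 1 = (-((c₀ - d₀) * (a₁ - d₁) - (c₁ - d₁) * (a₀ - d₀)) / Δ) * w 3
          + c * (c₀ * a₁ - c₁ * a₀) / Δ ∧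
      w 2 = (-((a₀ - d₀) * (b₁ - d₁) - (a₁ - d₁) * (b₀ - d₀)) / Δ) * w 3
          + c * (a₀ * b₁ - a₁ * b₀) / Δ := by
    rintro c w ⟨h0, h1⟩ hs
    refine ⟨?_, ?_, ?_⟩
    · field_simp
      rw [hΔdef]
      linear_combination (b₁ - c₁) * h0 + (c₀ - b₀) * h1 + (b₀ * c₁ - b₁ * c₀) * hs
    · field_simp
      rw [hΔdef]
      linear_combination (c₁ - a₁) * h0 + (a₀ - c₀) * h1 + (c₀ * a₁ - c₁ * a₀) * hs
    · field_simp
      rw [hΔdef]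
      linear_combination (a₁ - b₁) * h0 + (b₀ - a₀) * h1 + (a₀ * b₁ - a₁ * b₀) * hs
  refine ⟨?_, ?_, ?_⟩
  · let u : Fin 4 → ℝ := ![-((b₀ - d₀) * (c₁ - d₁) - (b₁ - d₁) * (c₀ - d₀)) / Δ,
      -((c₀ - d₀) * (a₁ - d₁) - (c₁ - d₁) * (a₀ - d₀)) / Δ,
      -((a₀ - d₀) * (b₁ - d₁) - (a₁ - d₁) * (b₀ - d₀)) / Δ, 1]
    have hu : u ∈ K := by
      rw [hK]
      simp only [u, Matrix.cons_val]
      refine ⟨⟨?_, ?_⟩, ?_⟩ <;> (field_simp; rw [hΔdef]; ring)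
    refine finrank_eq_one (⟨u, hu⟩ : K) ?_ ?_
    · intro h
      have := congrFun (congrArg Subtype.val h) 3
      simp [u] at this
    · rintro ⟨w, hw⟩
      obtain ⟨h1, h2⟩ := (hK w).mp hw
      obtain ⟨k0, k1, k2⟩ := key 0 w h1 h2
      refine ⟨w 3, ?_⟩
      apply Subtype.ext
      funext i
      fin_cases i
      · change w 3 * _ = w 0
        rw [k0]; simp [u]; ring
      · change w 3 * _ = w 1
        rw [k1]; simp [u]; ring
      · change w 3 * _ = w 2
        rw [k2]; simp [u]; ring
      · change w 3 * _ = w 3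
        simp [u]
  · intro w hw hne h3
    obtain ⟨h1, h2⟩ := (hK w).mp hw
    obtain ⟨k0, k1, k2⟩ := key 0 w h1 h2
    apply hne
    funext i
    fin_cases i
    · simpa [h3] using k0
    · simpa [h3] using k1
    · simpa [h3] using k2
    · simpa using h3
  · intro c
    exact ⟨_, _, _, _, _, _, key c⟩
end

section
/- Let θ₁, θ₂, θ₃, θ₄ ∈ (0, π) with θ₁+θ₂+θ₃+θ₄ = 2π and sin(θ₃+θ₄) ≠ 0. Define r_B = sin(θ₃+θ₄)/sin θ₂, r_C = sin θ₁/sin θ₂, ρ_ACD = −sin θ₃/sin(θ₃+θ₄), ρ_ABD = sin(θ₂+θ₃)/sin θ₁. Then the coefficient a_A = (ρ_ACD·r_B + ρ_ABD·r_C − 1)/(1 + r_B + r_C) satisfies a_A < 0. -/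
open Real

lemma sin_add_lt_aux (x y : ℝ) (hx : x ∈ Set.Ioo 0 π) (hy : y ∈ Set.Ioo 0 π) :
    sin (x + y) < sin x + sin y := by
  have sx := sin_pos_of_mem_Ioo hx
  have sy := sin_pos_of_mem_Ioo hy
  have cx : cos x < 1 := by nlinarith [sin_sq_add_cos_sq x]
  have cy : cos y < 1 := by nlinarith [sin_sq_add_cos_sq y]
  rw [sin_add]
  nlinarith [mul_pos sx (sub_pos.2 cy), mul_pos sy (sub_pos.2 cx)]

/-- Negativity of the coefficient `a_A` (part of the plasticity principle,
Theorem 3). -/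
theorem coeff_aA_neg
    (θ1 θ2 θ3 θ4 : ℝ)
    (h1 : θ1 ∈ Set.Ioo 0 π) (h2 : θ2 ∈ Set.Ioo 0 π)
    (h3 : θ3 ∈ Set.Ioo 0 π) (h4 : θ4 ∈ Set.Ioo 0 π)
    (hsum : θ1 + θ2 + θ3 + θ4 = 2 * π)
    (h34 : sin (θ3 + θ4) ≠ 0)
    (rB rC ρACD ρABD aA : ℝ)
    (hrB : rB = sin (θ3 + θ4) / sin θ2)
    (hrC : rC = sin θ1 / sin θ2)
    (hACD : ρACD = -sin θ3 / sin (θ3 + θ4))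
    (hABD : ρABD = sin (θ2 + θ3) / sin θ1)
    (haA : aA = (ρACD * rB + ρABD * rC - 1) / (1 + rB + rC)) :
    aA < 0 := by
  have s1 := sin_pos_of_mem_Ioo h1
  have s2 := sin_pos_of_mem_Ioo h2
  have e : sin (θ3 + θ4) = -sin (θ1 + θ2) := by
    rw [show θ3 + θ4 = 2 * π - (θ1 + θ2) by linarith, sin_two_pi_sub]
  have hn := sin_add_lt_aux θ2 θ3 h2 h3
  have hd := sin_add_lt_aux θ1 θ2 h1 h2
  have en : ρACD * rB + ρABD * rC - 1
      = (sin (θ2 + θ3) - sin θ3 - sin θ2) / sin θ2 := by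
    rw [hACD, hrB, hABD, hrC]
    field_simp
    ring
  have ed : 1 + rB + rC = (sin θ2 + sin (θ3 + θ4) + sin θ1) / sin θ2 := by
    rw [hrB, hrC]
    field_simp
  rw [haA, en, ed]
  exact div_neg_of_neg_of_pos (div_neg_of_neg_of_pos (by linarith) s2)
    (div_pos (by linarith) s2)
end

section
/- Let θ₁, θ₂, θ₃, θ₄ ∈ (0, π) with θ₁+θ₂+θ₃+θ₄ = 2π, sin(θ₃+θ₄) ≠ 0 and sin(θ₂+θ₃) > 0. With r_B = sin(θ₃+θ₄)/sin θ₂, r_C = sin θ₁/sin θ₂, ρ_ACD = −sin θ₃/sin(θ₃+θ₄), ρ_ABD = sin(θ₂+θ₃)/sin θ₁ and a_A = (ρ_ACD·r_B + ρ_ABD·r_C − 1)/(1 + r_B + r_C), the coefficient a_C = a_A·r_C − ρ_ABD·r_C satisfies a_C < 0. -/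
open Real

/-- Negativity of the coefficient `a_C` (part of the plasticity principle,
Theorem 3). -/
theorem coeff_aC_neg
    (θ1 θ2 θ3 θ4 : ℝ)
    (h1 : θ1 ∈ Set.Ioo 0 π) (h2 : θ2 ∈ Set.Ioo 0 π)
    (h3 : θ3 ∈ Set.Ioo 0 π) (h4 : θ4 ∈ Set.Ioo 0 π)
    (hsum : θ1 + θ2 + θ3 + θ4 = 2 * π)
    (h34 : sin (θ3 + θ4) ≠ 0) (h23 : 0 < sin (θ2 + θ3))
    (rB rC ρACD ρABD aA aC : ℝ)
    (hrB : rB = sin (θ3 + θ4) / sin θ2)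
    (hrC : rC = sin θ1 / sin θ2)
    (hACD : ρACD = -sin θ3 / sin (θ3 + θ4))
    (hABD : ρABD = sin (θ2 + θ3) / sin θ1)
    (haA : aA = (ρACD * rB + ρABD * rC - 1) / (1 + rB + rC))
    (haC : aC = aA * rC - ρABD * rC) :
    aC < 0 := by
  have s1 := sin_pos_of_pos_of_lt_pi h1.1 h1.2
  have s2 := sin_pos_of_pos_of_lt_pi h2.1 h2.2
  have s3 := sin_pos_of_pos_of_lt_pi h3.1 h3.2
  have key : ∀ x : ℝ, 0 < sin x → 0 < 1 - cos x := by
    intro x hx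
    nlinarith [sin_sq_add_cos_sq x, cos_le_one x, mul_pos hx hx]
  have c1 := key _ s1
  have c2 := key _ s2
  have c3 := key _ s3
  have hS : sin (θ3 + θ4) = -sin (θ1 + θ2) := by
    rw [show θ3 + θ4 = 2 * π - (θ1 + θ2) by linarith, sin_two_pi_sub]
  have hD : 0 < sin θ2 + sin (θ3 + θ4) + sin θ1 := by
    rw [hS, sin_add]
    nlinarith [mul_pos s1 c2, mul_pos s2 c1]
  have hN : sin (θ2 + θ3) - sin θ3 - sin θ2 < 0 := by
    rw [sin_add]
    nlinarith [mul_pos s2 c3, mul_pos s3 c2]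
  have hrCpos : 0 < rC := hrC ▸ div_pos s1 s2
  have hρ : 0 < ρABD := hABD ▸ div_pos h23 s1
  have e1 : ρACD * rB + ρABD * rC - 1 = (sin (θ2 + θ3) - sin θ3 - sin θ2) / sin θ2 := by
    rw [hACD, hrB, hABD, hrC]
    field_simp
    ring
  have e2 : 1 + rB + rC = (sin θ2 + sin (θ3 + θ4) + sin θ1) / sin θ2 := by
    rw [hrB, hrC]
    field_simp
  have hA : aA < 0 := by
    rw [haA, e1, e2]
    exact div_neg_of_neg_of_pos (div_neg_of_neg_of_pos hN s2) (div_pos hD s2)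
  rw [haC]
  nlinarith [mul_pos hρ hrCpos, mul_neg_of_neg_of_pos hA hrCpos]
end

section
/- Let θ₁, θ₂, θ₃, θ₄ ∈ (0, π) with θ₁+θ₂+θ₃+θ₄ = 2π. Then the quotient a_B = (sin(θ₃+θ₄) − sin θ₃ − 2·sin θ₄) / (−sin θ₂ − sin(θ₃+θ₄) − 2·sin θ₁) satisfies a_B > 0; indeed the numerator is at most −sin θ₄ < 0 and the denominator is at most −sin θ₁ − sin θ₂ − (sin θ₁ − sin(θ₁+θ₂)) < 0, both strictly negative. -/
open Real

/-- Positivity of the coefficient `a_B` (part of the plasticity principle,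
Theorem 3): the numerator and denominator of `a_B` are both strictly
negative, hence `a_B > 0`. -/
theorem coeff_aB_pos
    (θ1 θ2 θ3 θ4 : ℝ)
    (h1 : θ1 ∈ Set.Ioo 0 π) (h2 : θ2 ∈ Set.Ioo 0 π)
    (h3 : θ3 ∈ Set.Ioo 0 π) (h4 : θ4 ∈ Set.Ioo 0 π)
    (hsum : θ1 + θ2 + θ3 + θ4 = 2 * π) :
    (sin (θ3 + θ4) - sin θ3 - 2 * sin θ4 ≤ -sin θ4 ∧ -sin θ4 < 0)
    ∧ (-sin θ2 - sin (θ3 + θ4) - 2 * sin θ1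
        ≤ -sin θ1 - sin θ2 - (sin θ1 - sin (θ1 + θ2))
      ∧ -sin θ1 - sin θ2 - (sin θ1 - sin (θ1 + θ2)) < 0)
    ∧ 0 < (sin (θ3 + θ4) - sin θ3 - 2 * sin θ4)
        / (-sin θ2 - sin (θ3 + θ4) - 2 * sin θ1) := by
  have key : ∀ a b : ℝ, a ∈ Set.Ioo 0 π → b ∈ Set.Ioo 0 π →
      sin (a + b) ≤ sin a + sin b := by
    intro a b ha hb
    have hsa := sin_pos_of_mem_Ioo ha
    have hsb := sin_pos_of_mem_Ioo hb
    rw [sin_add]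
    nlinarith [cos_le_one a, cos_le_one b]
  have e : sin (θ3 + θ4) = -sin (θ1 + θ2) := by
    have : θ3 + θ4 = 2 * π - (θ1 + θ2) := by linarith
    rw [this, sin_two_pi_sub]
  have k1 := key θ1 θ2 h1 h2
  have k2 := key θ3 θ4 h3 h4
  have s1 := sin_pos_of_mem_Ioo h1
  have s4 := sin_pos_of_mem_Ioo h4
  refine ⟨⟨by linarith, by linarith⟩, ⟨by linarith, by linarith⟩, ?_⟩
  exact div_pos_of_neg_of_neg (by linarith) (by linarith)
end

section
/- Let 0 = φ_A < φ_B < φ_C < φ_D < 2π with φ_D = φ_B + π, and set v_R = (cos φ_R, sin φ_R) for R ∈ {A,B,C,D}. (i) Every quadruple of positive reals (w_A,w_B,w_C,w_D) with w_A·v_A + w_B·v_B + w_C·v_C + w_D·v_D = 0 satisfies w_A·sin(φ_A−φ_B) + w_C·sin(φ_C−φ_B) = 0, i.e. w_A = −(sin(φ_C−φ_B)/sin(φ_A−φ_B))·w_C with positive proportionality factor. (ii) If (w'_A,w'_B,w'_C,w'_D) is a second such positive quadruple with the same total weight and w'_D > w_D, then w'_A < w_A, w'_C < w_C and w'_B >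 w_B. -/
open Real

/-- Proposition 1: the plasticity principle persists when the weighted
Fermat–Torricelli point lies on the diagonal `BD` (i.e. `φ_D = φ_B + π`). -/
theorem plasticity_on_diagonal_BD
    (φA φB φC φD : ℝ)
    (hφA : φA = 0) (hAB : φA < φB) (hBC : φB < φC) (hCD : φC < φD)
    (hD2 : φD < 2 * π) (hDB : φD = φB + π) :
    (∀ wA wB wC wD : ℝ, 0 < wA → 0 < wB → 0 < wC → 0 < wD →
      wA • ((cos φA, sin φA) : ℝ × ℝ) + wB • ((cos φB, sin φB) : ℝ × ℝ)
        + wC • ((cos φC, sin φC) : ℝ × ℝ) + wD • ((cos φD, sin φD) : ℝ × ℝ) = 0 →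
      wA * sin (φA - φB) + wC * sin (φC - φB) = 0
        ∧ wA = -(sin (φC - φB) / sin (φA - φB)) * wC
        ∧ 0 < -(sin (φC - φB) / sin (φA - φB)))
    ∧ ∀ wA wB wC wD wA' wB' wC' wD' : ℝ,
        0 < wA → 0 < wB → 0 < wC → 0 < wD →
        0 < wA' → 0 < wB' → 0 < wC' → 0 < wD' →
        wA • ((cos φA, sin φA) : ℝ × ℝ) + wB • ((cos φB, sin φB) : ℝ × ℝ)
          + wC • ((cos φC, sin φC) : ℝ × ℝ) + wD • ((cos φD, sin φD) : ℝ × ℝ) = 0 →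
        wA' • ((cos φA, sin φA) : ℝ × ℝ) + wB' • ((cos φB, sin φB) : ℝ × ℝ)
          + wC' • ((cos φC, sin φC) : ℝ × ℝ) + wD' • ((cos φD, sin φD) : ℝ × ℝ) = 0 →
        wA + wB + wC + wD = wA' + wB' + wC' + wD' →
        wD < wD' →
        wA' < wA ∧ wC' < wC ∧ wB < wB' := by
  obtain ⟨θ, rfl⟩ : ∃ θ, φC = φB + θ := ⟨φC - φB, by ring⟩
  subst hφA hDB
  have hs : 0 < sin φB := sin_pos_of_pos_of_lt_pi hAB (by linarith)
  have ht : 0 < sin θ := sin_pos_of_pos_of_lt_pi (by linarith) (by linarith)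
  have h1 := sin_sq_add_cos_sq φB
  have h2 := sin_sq_add_cos_sq θ
  have key : ∀ a b c d : ℝ,
      a • ((cos 0, sin 0) : ℝ × ℝ) + b • ((cos φB, sin φB) : ℝ × ℝ)
        + c • ((cos (φB + θ), sin (φB + θ)) : ℝ × ℝ)
        + d • ((cos (φB + π), sin (φB + π)) : ℝ × ℝ) = 0 →
      a * sin φB = c * sin θ ∧ b - d + a * cos φB + c * cos θ = 0 := by
    intro a b c d h
    have hx := congrArg Prod.fst h
    have hy := congrArg Prod.snd h
    simp [cos_add, sin_add] at hx hy
    constructor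
    · linear_combination sin φB * hx - cos φB * hy + c * sin θ * h1
    · linear_combination cos φB * hx + sin φB * hy - (b - d + c * cos θ) * h1
  constructor
  · intro a b c d ha hb hc hd h
    obtain ⟨k, -⟩ := key a b c d h
    have e1 : sin (0 - φB) = - sin φB := by simp
    have e2 : φB + θ - φB = θ := by ring
    rw [e1, e2]
    have e3 : -(sin θ / -sin φB) = sin θ / sin φB := by rw [div_neg, neg_neg]
    rw [e3]
    refine ⟨by linarith, ?_, div_pos ht hs⟩
    field_simp
    linarith
  · intro a b c d a' b' c' d' _ _ _ _ _ _ _ _ h h' hsum hd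
    obtain ⟨k1, k2⟩ := key a b c d h
    obtain ⟨k1', k2'⟩ := key a' b' c' d' h'
    have p1 : cos φB < 1 := by nlinarith
    have p2 : -1 < cos φB := by nlinarith
    have q1 : cos θ < 1 := by nlinarith
    have q2 : -1 < cos θ := by nlinarith
    have k : (a' - a) * sin φB = (c' - c) * sin θ := by linarith
    have m : 2 * (d' - d) = -((a' - a) * (1 - cos φB)) - (c' - c) * (1 - cos θ) := by
      linarith
    have n : 2 * (b' - b) = (a - a') * (1 + cos φB) + (c - c') * (1 + cos θ) := by
      linarith
    have ha : a' < a := by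
      by_contra! hh
      have u : 0 ≤ (c' - c) * sin θ := k ▸ mul_nonneg (by linarith) hs.le
      have v : 0 ≤ c' - c := nonneg_of_mul_nonneg_left u ht
      have := mul_nonneg v (by linarith : 0 ≤ 1 - cos θ)
      have := mul_nonneg (sub_nonneg.2 hh) (by linarith : 0 ≤ 1 - cos φB)
      linarith
    have hc : c' < c := by
      by_contra! hh
      have := mul_nonneg (sub_nonneg.2 hh) ht.le
      have := mul_pos (sub_pos.2 ha) hs
      linarith
    refine ⟨ha, hc, ?_⟩
    have := mul_pos (sub_pos.2 ha) (by linarith : 0 < 1 + cos φB)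
    have := mul_pos (sub_pos.2 hc) (by linarith : 0 < 1 + cos θ)
    linarith
end

section
/- Let v_A, v_B, v_C, v_D be unit vectors in ℝ² and let (w_A,w_B,w_C,w_D) be a quadruple of positive reals with w_A·v_A + w_B·v_B + w_C·v_C + w_D·v_D = 0. Then there exists a quadruple (w'_A,w'_B,w'_C,w'_D) of positive reals, different from (w_A,w_B,w_C,w_D), with w'_A·v_A + w'_B·v_B + w'_C·v_C + w'_D·v_D = 0 and w'_A+w'_B+w'_C+w'_D = w_A+w_B+w_C+w_D. In other words, the 4-inverse weighted Fermat–Torricelli problem never has a unique solution. -/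
/-- The 4-inverse weighted Fermat–Torricelli problem never has a unique
solution: any balancing quadruple of positive weights admits a different
balancing quadruple of positive weights with the same total sum. -/
theorem four_inverse_FT_not_unique
    (vA vB vC vD : EuclideanSpace ℝ (Fin 2))
    (huA : ‖vA‖ = 1) (huB : ‖vB‖ = 1) (huC : ‖vC‖ = 1) (huD : ‖vD‖ = 1)
    (wA wB wC wD : ℝ)
    (hwA : 0 < wA) (hwB : 0 < wB) (hwC : 0 < wC) (hwD : 0 < wD)
    (hbal : wA • vA + wB • vB + wC • vC + wD • vD = 0) :
    ∃ wA' wB' wC' wD' : ℝ,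
      0 < wA' ∧ 0 < wB' ∧ 0 < wC' ∧ 0 < wD'
      ∧ (wA', wB', wC', wD') ≠ (wA, wB, wC, wD)
      ∧ wA' • vA + wB' • vB + wC' • vC + wD' • vD = 0
      ∧ wA' + wB' + wC' + wD' = wA + wB + wC + wD := by
  let f := Fintype.linearCombination ℝ
    (![(vA, 1), (vB, 1), (vC, 1), (vD, 1)] : Fin 4 → EuclideanSpace ℝ (Fin 2) × ℝ)
  have hk : LinearMap.ker f ≠ ⊥ := by
    apply LinearMap.ker_ne_bot_of_finrank_lt
    simp
  obtain ⟨u, hu, hu0⟩ := (Submodule.ne_bot_iff _).1 hk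
  rw [LinearMap.mem_ker] at hu
  simp only [f, Fintype.linearCombination_apply, Fin.sum_univ_four] at hu
  have h1 : u 0 • vA + u 1 • vB + u 2 • vC + u 3 • vD = 0 := by
    simpa using congrArg Prod.fst hu
  have h2 : u 0 + u 1 + u 2 + u 3 = 0 := by
    simpa using congrArg Prod.snd hu
  have key : ∀ a w : ℝ, 0 < w → ∀ᶠ t in nhdsWithin (0 : ℝ) (Set.Ioi 0), 0 < w + t * a := by
    intro a w hw
    apply Filter.Eventually.filter_mono nhdsWithin_le_nhds
    have hc : Continuous fun t : ℝ => w + t * a := by fun_prop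
    exact hc.continuousAt.eventually (lt_mem_nhds (by simpa using hw))
  obtain ⟨t, hA, hB, hC, hD, ht⟩ := ((key (u 0) wA hwA).and ((key (u 1) wB hwB).and
    ((key (u 2) wC hwC).and ((key (u 3) wD hwD).and self_mem_nhdsWithin)))).exists
  have ht' : t ≠ 0 := ne_of_gt ht
  refine ⟨_, _, _, _, hA, hB, hC, hD, ?_, ?_, ?_⟩
  · intro h
    simp [ht'] at h
    apply hu0
    ext i
    fin_cases i <;> simp [h]
  · have : (wA • vA + wB • vB + wC • vC + wD • vD)
      + t • (u 0 • vA + u 1 • vB + u 2 • vC + u 3 • vD) = 0 := by rw [hbal, h1]; simp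
    rw [← this]
    module
  · linear_combination t * h2
end

section
/- Let v₁, v₂, v₃ be pairwise distinct unit vectors in ℝ². Then the linear map ℝ³ → ℝ² × ℝ sending (w₁,w₂,w₃) to (w₁·v₁ + w₂·v₂ + w₃·v₃, w₁+w₂+w₃) is injective. Consequently, if two triples of weights both satisfy the balancing condition Σ wᵢ·vᵢ = 0 and have the same total sum, they are equal: the 3-inverse weighted Fermat–Torricelli problem has at most one solution. -/
lemma ft_mul_zero (x y z : EuclideanSpace ℝ (Fin 2)) (hx : ‖x‖ = 1) (hy : ‖y‖ = 1)
    (hz : ‖z‖ = 1) (h : x ≠ y) (a b c : ℝ) (hv : a • x + b • y + c • z = 0)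
    (hs : a + b + c = 0) : a * b = 0 := by
  have hlt : inner ℝ x y < 1 := (inner_lt_one_iff_real_of_norm_eq_one hx hy).2 h
  have he : a • x + b • y = (-c) • z := by
    rw [neg_smul]; exact eq_neg_of_add_eq_zero_left hv
  have hn : ‖a • x + b • y‖ ^ 2 = ‖(-c) • z‖ ^ 2 := by rw [he]
  rw [norm_add_sq_real, norm_smul, norm_smul, norm_smul, hx, hy, hz, real_inner_smul_left,
    real_inner_smul_right] at hn
  simp only [mul_one, Real.norm_eq_abs, sq_abs] at hn
  have hc : -c = a + b := by linarith
  rw [hc] at hn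
  have h0 : (a * b) * (1 - inner ℝ x y) = 0 := by linarith
  exact (mul_eq_zero.1 h0).resolve_right (by linarith)

lemma ft_kernel (x y z : EuclideanSpace ℝ (Fin 2)) (hx : ‖x‖ = 1) (hy : ‖y‖ = 1)
    (hz : ‖z‖ = 1) (hxy : x ≠ y) (hxz : x ≠ z) (hyz : y ≠ z) (a b c : ℝ)
    (hv : a • x + b • y + c • z = 0) (hs : a + b + c = 0) : a = 0 ∧ b = 0 ∧ c = 0 := by
  have h1 := ft_mul_zero x y z hx hy hz hxy a b c hv hs
  have h2 := ft_mul_zero x z y hx hz hy hxz a c b (by rw [← hv]; abel) (by linarith)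
  have h3 := ft_mul_zero y z x hy hz hx hyz b c a (by rw [← hv]; abel) (by linarith)
  refine ⟨?_, ?_, ?_⟩ <;> apply pow_eq_zero_iff (two_ne_zero) |>.1
  · linear_combination a * hs - h1 - h2
  · linear_combination b * hs - h1 - h3
  · linear_combination c * hs - h2 - h3

/-- The 3-inverse weighted Fermat–Torricelli problem has at most one solution:
for pairwise distinct unit vectors `v₁, v₂, v₃` in the plane, the map
`(w₁,w₂,w₃) ↦ (w₁v₁ + w₂v₂ + w₃v₃, w₁+w₂+w₃)` is injective. -/
theorem three_inverse_FT_unique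
    (v1 v2 v3 : EuclideanSpace ℝ (Fin 2))
    (hu1 : ‖v1‖ = 1) (hu2 : ‖v2‖ = 1) (hu3 : ‖v3‖ = 1)
    (h12 : v1 ≠ v2) (h13 : v1 ≠ v3) (h23 : v2 ≠ v3) :
    Function.Injective (fun w : ℝ × ℝ × ℝ =>
      (w.1 • v1 + w.2.1 • v2 + w.2.2 • v3, w.1 + w.2.1 + w.2.2))
    ∧ ∀ w1 w2 w3 w1' w2' w3' : ℝ,
        w1 • v1 + w2 • v2 + w3 • v3 = 0 →
        w1' • v1 + w2' • v2 + w3' • v3 = 0 →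
        w1 + w2 + w3 = w1' + w2' + w3' →
        w1 = w1' ∧ w2 = w2' ∧ w3 = w3' := by
  have key : ∀ w1 w2 w3 w1' w2' w3' : ℝ,
      w1 • v1 + w2 • v2 + w3 • v3 = w1' • v1 + w2' • v2 + w3' • v3 →
      w1 + w2 + w3 = w1' + w2' + w3' → w1 = w1' ∧ w2 = w2' ∧ w3 = w3' := by
    intro w1 w2 w3 w1' w2' w3' hv hs
    obtain ⟨h1, h2, h3⟩ := ft_kernel v1 v2 v3 hu1 hu2 hu3 h12 h13 h23
      (w1 - w1') (w2 - w2') (w3 - w3')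
      (by rw [← sub_eq_zero] at hv; rw [← hv]; module) (by linarith)
    exact ⟨sub_eq_zero.1 h1, sub_eq_zero.1 h2, sub_eq_zero.1 h3⟩
  refine ⟨?_, fun w1 w2 w3 w1' w2' w3' h h' hs => key _ _ _ _ _ _ (h.trans h'.symm) hs⟩
  rintro ⟨a, b, c⟩ ⟨a', b', c'⟩ h
  obtain ⟨hv, hs⟩ := Prod.mk.inj h
  obtain ⟨rfl, rfl, rfl⟩ := key _ _ _ _ _ _ hv hs
  rfl
end

section
/- Let A, B, C, D ∈ ℝ², let w_A, w_B, w_C, w_D be positive reals, and suppose P ∉ {A,B,C,D} is a global minimizer of f(X) = Σ_{R∈{A,B,C,D}} w_R‖X−R‖. For each R choose t_R > 0 and set R' = P + t_R·(R−P). Then P is also a global minimizer of f'(X) = Σ_{R∈{A,B,C,D}} w_R‖X−R'‖; that is, the weighted Fermat–Torricelli point is invariant under moving each vertex along its ray from P (geometric plasticity / invariance property). -/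
/-- Quadratic upper bound for the norm along a line. -/
lemma norm_line_upper {E : Type*} [NormedAddCommGroup E] [InnerProductSpace ℝ E]
    (a v : E) (ha : a ≠ 0) (s : ℝ) :
    ‖a + s • v‖ ≤ ‖a‖ + s * (inner ℝ a v / ‖a‖) + s ^ 2 * (‖v‖ ^ 2 / (2 * ‖a‖)) := by
  have h0 : 0 < ‖a‖ := norm_pos_iff.mpr ha
  have h1 : ‖a + s • v‖ ^ 2 = ‖a‖ ^ 2 + 2 * (s * inner ℝ a v) + s ^ 2 * ‖v‖ ^ 2 := by
    rw [norm_add_sq_real, inner_smul_right, norm_smul, mul_pow, Real.norm_eq_abs, sq_abs]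
  have h2 : ‖a‖ + s * (inner ℝ a v / ‖a‖) + s ^ 2 * (‖v‖ ^ 2 / (2 * ‖a‖))
      = (‖a + s • v‖ ^ 2 + ‖a‖ ^ 2) / (2 * ‖a‖) := by
    rw [h1]; field_simp; ring
  rw [h2, le_div_iff₀ (by positivity)]
  nlinarith [sq_nonneg (‖a + s • v‖ - ‖a‖)]

/-- Subgradient inequality for the norm at a positive multiple of `a`. -/
lemma norm_ray_lower {E : Type*} [NormedAddCommGroup E] [InnerProductSpace ℝ E]
    (a v : E) (ha : a ≠ 0) (t : ℝ) (ht : 0 < t) :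
    ‖t • a‖ + inner ℝ a v / ‖a‖ ≤ ‖t • a + v‖ := by
  have h0 : 0 < ‖a‖ := norm_pos_iff.mpr ha
  have h1 : inner ℝ a (t • a + v) = t * ‖a‖ ^ 2 + inner ℝ a v := by
    rw [inner_add_right, inner_smul_right, real_inner_self_eq_norm_sq]
  have h2 := real_inner_le_norm a (t • a + v)
  have h3 : ‖t • a‖ + inner ℝ a v / ‖a‖ = inner ℝ a (t • a + v) / ‖a‖ := by
    rw [h1, norm_smul, Real.norm_of_nonneg ht.le]; field_simp
  rw [h3, div_le_iff₀ h0]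
  linarith

/-- Geometric plasticity (invariance property): the weighted Fermat–Torricelli
point is invariant under moving each vertex along its ray from the minimizer. -/
theorem weighted_FT_invariance
    (A B C D P : EuclideanSpace ℝ (Fin 2))
    (wA wB wC wD : ℝ)
    (hwA : 0 < wA) (hwB : 0 < wB) (hwC : 0 < wC) (hwD : 0 < wD)
    (hP : P ∉ ({A, B, C, D} : Set (EuclideanSpace ℝ (Fin 2))))
    (hmin : ∀ X : EuclideanSpace ℝ (Fin 2),
      wA * ‖P - A‖ + wB * ‖P - B‖ + wC * ‖P - C‖ + wD * ‖P - D‖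
        ≤ wA * ‖X - A‖ + wB * ‖X - B‖ + wC * ‖X - C‖ + wD * ‖X - D‖)
    (tA tB tC tD : ℝ)
    (htA : 0 < tA) (htB : 0 < tB) (htC : 0 < tC) (htD : 0 < tD)
    (A' B' C' D' : EuclideanSpace ℝ (Fin 2))
    (hA' : A' = P + tA • (A - P)) (hB' : B' = P + tB • (B - P))
    (hC' : C' = P + tC • (C - P)) (hD' : D' = P + tD • (D - P)) :
    ∀ X : EuclideanSpace ℝ (Fin 2),
      wA * ‖P - A'‖ + wB * ‖P - B'‖ + wC * ‖P - C'‖ + wD * ‖P - D'‖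
        ≤ wA * ‖X - A'‖ + wB * ‖X - B'‖ + wC * ‖X - C'‖ + wD * ‖X - D'‖ := by
  intro X
  simp only [Set.mem_insert_iff, Set.mem_singleton_iff, not_or] at hP
  obtain ⟨hA, hB, hC, hD⟩ := hP
  have up : ∀ R : EuclideanSpace ℝ (Fin 2), P ≠ R → ∀ s : ℝ, ‖P + s • (X - P) - R‖ ≤
      ‖P - R‖ + s * (inner ℝ (P - R) (X - P) / ‖P - R‖)
        + s ^ 2 * (‖X - P‖ ^ 2 / (2 * ‖P - R‖)) := by
    intro R hR s
    have h := norm_line_upper (P - R) (X - P) (sub_ne_zero.mpr hR) s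
    rwa [show P - R + s • (X - P) = P + s • (X - P) - R by abel] at h
  have lo : ∀ R : EuclideanSpace ℝ (Fin 2), P ≠ R → ∀ t : ℝ, 0 < t →
      ‖P - (P + t • (R - P))‖ + inner ℝ (P - R) (X - P) / ‖P - R‖
        ≤ ‖X - (P + t • (R - P))‖ := by
    intro R hR t ht
    have h := norm_ray_lower (P - R) (X - P) (sub_ne_zero.mpr hR) t ht
    rwa [show t • (P - R) + (X - P) = X - (P + t • (R - P)) by module,
      show t • (P - R) = P - (P + t • (R - P)) by module] at h
  have uA := up A hA
  have uB := up B hB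
  have uC := up C hC
  have uD := up D hD
  have lA := mul_le_mul_of_nonneg_left (lo A hA tA htA) hwA.le
  have lB := mul_le_mul_of_nonneg_left (lo B hB tB htB) hwB.le
  have lC := mul_le_mul_of_nonneg_left (lo C hC tC htC) hwC.le
  have lD := mul_le_mul_of_nonneg_left (lo D hD tD htD) hwD.le
  rw [← hA'] at lA
  rw [← hB'] at lB
  rw [← hC'] at lC
  rw [← hD'] at lD
  have kA : 0 ≤ ‖X - P‖ ^ 2 / (2 * ‖P - A‖) := by positivity
  have kB : 0 ≤ ‖X - P‖ ^ 2 / (2 * ‖P - B‖) := by positivity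
  have kC : 0 ≤ ‖X - P‖ ^ 2 / (2 * ‖P - C‖) := by positivity
  have kD : 0 ≤ ‖X - P‖ ^ 2 / (2 * ‖P - D‖) := by positivity
  generalize ‖X - P‖ ^ 2 / (2 * ‖P - A‖) = a at *
  generalize ‖X - P‖ ^ 2 / (2 * ‖P - B‖) = b at *
  generalize ‖X - P‖ ^ 2 / (2 * ‖P - C‖) = c at *
  generalize ‖X - P‖ ^ 2 / (2 * ‖P - D‖) = d at *
  generalize inner ℝ (P - A) (X - P) / ‖P - A‖ = p at *
  generalize inner ℝ (P - B) (X - P) / ‖P - B‖ = q at *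
  generalize inner ℝ (P - C) (X - P) / ‖P - C‖ = r at *
  generalize inner ℝ (P - D) (X - P) / ‖P - D‖ = u at *
  obtain ⟨L, hL⟩ : ∃ L, L = wA * p + wB * q + wC * r + wD * u := ⟨_, rfl⟩
  obtain ⟨K, hK⟩ : ∃ K, K = wA * a + wB * b + wC * c + wD * d := ⟨_, rfl⟩
  have hK0 : 0 ≤ K := by rw [hK]; positivity
  have key : ∀ s : ℝ, 0 ≤ s * L + s ^ 2 * K := by
    intro s
    have h := hmin (P + s • (X - P))
    have eA := mul_le_mul_of_nonneg_left (uA s) hwA.le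
    have eB := mul_le_mul_of_nonneg_left (uB s) hwB.le
    have eC := mul_le_mul_of_nonneg_left (uC s) hwC.le
    have eD := mul_le_mul_of_nonneg_left (uD s) hwD.le
    rw [hL, hK]
    linarith
  have hL0 : 0 ≤ L := by
    by_contra hneg
    push Not at hneg
    have h := key (-L / (K + 1))
    have e : -L / (K + 1) * L + (-L / (K + 1)) ^ 2 * K = -(L ^ 2 / (K + 1) ^ 2) := by
      field_simp; ring
    have : 0 < L ^ 2 / (K + 1) ^ 2 := by
      have := sq_pos_of_neg hneg
      positivity
    linarith
  linarith
end

section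
/- Let φ_A, φ_B, φ_C, φ_D ∈ ℝ and w_A, w_B, w_C, w_D ∈ ℝ satisfy the two cosine equations Σ_{Q∈{A,B,C,D}} w_Q·cos(φ_Q − φ_A) = 0 and Σ_{Q∈{A,B,C,D}} w_Q·cos(φ_Q − φ_B) = 0. If sin(φ_B − φ_A) ≠ 0, then the two sine equations hold: w_B·sin(φ_B−φ_A) + w_C·sin(φ_C−φ_A) + w_D·sin(φ_D−φ_A) = 0 and w_A·sin(φ_A−φ_B) + w_C·sin(φ_C−φ_B) + w_D·sin(φ_D−φ_B) = 0. -/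
open Real

/-- From the cosine equations at `A` and at `B` (with `sin (φ_B - φ_A) ≠ 0`)
one deduces the sine equations (2.14)–(2.16). -/
theorem cosine_equations_imply_sine_equations
    (φA φB φC φD : ℝ) (wA wB wC wD : ℝ)
    (hcosA : wA * cos (φA - φA) + wB * cos (φB - φA)
      + wC * cos (φC - φA) + wD * cos (φD - φA) = 0)
    (hcosB : wA * cos (φA - φB) + wB * cos (φB - φB)
      + wC * cos (φC - φB) + wD * cos (φD - φB) = 0)
    (hBA : sin (φB - φA) ≠ 0) :
    wB * sin (φB - φA) + wC * sin (φC - φA) + wD * sin (φD - φA) = 0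
    ∧ wA * sin (φA - φB) + wC * sin (φC - φB) + wD * sin (φD - φB) = 0 := by
  simp only [cos_sub, sin_sub] at *
  have hX : wA * cos φA + wB * cos φB + wC * cos φC + wD * cos φD = 0 := by
    apply mul_right_cancel₀ hBA
    linear_combination sin φB * hcosA - sin φA * hcosB
  have hY : wA * sin φA + wB * sin φB + wC * sin φC + wD * sin φD = 0 := by
    apply mul_right_cancel₀ hBA
    linear_combination cos φA * hcosB - cos φB * hcosA
  constructor
  · linear_combination cos φA * hY - sin φA * hX
  · linear_combination cos φB * hY - sin φB * hX
end
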